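/- arXiv:math/0410145 — 6 statements merged into one kernel-verified Lean document; each statement's English description precedes it below -/
import Mathlib

section
/- Let I be a nonempty finite type and let M : Matrix I I ℤ be a symmetric negative definite matrix such that M i j ≥ 0 for all i ≠ j. If a vector D : I → ℤ satisfies (M *ᵥ D) i ≤ 0 for every i ∈ I, then D i ≥ 0 for every i ∈ I. (This is the fact, used in the paper, that every element of the Lipman semigroup of a resolution is an effective divisor.) -/
open Matrix

/-- The integral quadratic form of an integer matrix whose negative is positive definite over `ℝ`
is negative on nonzero vectors. -/
theorem Matrix.dotProduct_mulVec_neg_of_posDef_neg_map {I : Type*} [Fintype I]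
    {M : Matrix I I ℤ} (hM : ((-M).map (Int.cast : ℤ → ℝ)).PosDef) {x : I → ℤ} (hx : x ≠ 0) :
    x ⬝ᵥ (M *ᵥ x) < 0 := by
  have hx' : (fun i ↦ (x i : ℝ)) ≠ 0 := fun h ↦
    hx (funext fun i ↦ by simpa using congrFun h i)
  have h := hM.dotProduct_mulVec_pos hx'
  simp only [dotProduct, mulVec, map_apply, neg_apply, Pi.star_apply, star_trivial] at h ⊢
  norm_cast at h
  simpa [Finset.sum_neg_distrib] using h

/-- A matrix with nonnegative off-diagonal entries pairs the negative and positive parts of a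
vector nonnegatively. -/
theorem Matrix.negPart_dotProduct_mulVec_posPart_nonneg {I : Type*} [Fintype I]
    {M : Matrix I I ℤ} (hM : ∀ i j : I, i ≠ j → 0 ≤ M i j) (x : I → ℤ) :
    0 ≤ x⁻ ⬝ᵥ (M *ᵥ x⁺) := by
  simp only [dotProduct, mulVec, Finset.mul_sum]
  refine Finset.sum_nonneg fun i _ ↦ Finset.sum_nonneg fun j _ ↦ ?_
  rcases eq_or_ne i j with rfl | hij
  · rcases le_total 0 (x i) with h | h
    · simp [Pi.negPart_apply, negPart_eq_zero.2 h]
    · simp [Pi.posPart_apply, posPart_eq_zero.2 h]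
  · exact mul_nonneg (negPart_nonneg x i) (mul_nonneg (hM i j hij) (posPart_nonneg x j))

/-- Every element of the Lipman semigroup of a (negative definite, symmetric,
with nonnegative off-diagonal entries) intersection matrix is effective:
if `(M *ᵥ D) i ≤ 0` for all `i`, then `D i ≥ 0` for all `i`. -/
theorem lipman_semigroup_effective {I : Type*} [Fintype I] [Nonempty I]
    (M : Matrix I I ℤ) (hsymm : M.IsSymm)
    (hnegdef : ((-M).map (Int.cast : ℤ → ℝ)).PosDef)
    (hoff : ∀ i j : I, i ≠ j → 0 ≤ M i j)
    (D : I → ℤ) (hD : ∀ i : I, (M *ᵥ D) i ≤ 0) :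
    ∀ i : I, 0 ≤ D i := by
  have hneg : D⁻ = 0 := by
    by_contra hne
    have hquad := dotProduct_mulVec_neg_of_posDef_neg_map hnegdef hne
    have hcross := negPart_dotProduct_mulVec_posPart_nonneg hoff D
    have hpair : D⁻ ⬝ᵥ (M *ᵥ D) ≤ 0 := Finset.sum_nonpos fun i _ ↦
      mul_nonpos_of_nonneg_of_nonpos (negPart_nonneg D i) (hD i)
    have hsplit : D⁻ ⬝ᵥ (M *ᵥ D) = D⁻ ⬝ᵥ (M *ᵥ D⁺) - D⁻ ⬝ᵥ (M *ᵥ D⁻) := by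
      rw [← dotProduct_sub, ← mulVec_sub, posPart_sub_negPart]
    linarith
  exact negPart_eq_zero.1 hneg
end

section
/- Let I be a nonempty finite type and let M : Matrix I I ℤ be a symmetric negative definite matrix. Then there exists a vector D : I → ℤ with (M *ᵥ D) i < 0 for every i ∈ I. (The strict Lipman semigroup is always non-empty.) -/
open Matrix

/-- An integer matrix with nonzero determinant sends some integer vector to a vector all of whose
coordinates are negative. -/
theorem exists_mulVec_neg_of_det_ne_zero {I : Type*} [Fintype I] [DecidableEq I]
    {M : Matrix I I ℤ} (hM : M.det ≠ 0) : ∃ D : I → ℤ, ∀ i : I, (M *ᵥ D) i < 0 := by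
  refine ⟨M.adjugate *ᵥ fun _ => -M.det, fun i => ?_⟩
  rw [mulVec_mulVec, mul_adjugate, smul_mulVec, one_mulVec, Pi.smul_apply, smul_eq_mul, mul_neg,
    neg_lt_zero]
  exact mul_self_pos.mpr hM

/-- The strict Lipman semigroup of a symmetric negative definite intersection
matrix is non-empty: there exists `D` with `(M *ᵥ D) i < 0` for all `i`. -/
theorem strict_lipman_cone_nonempty {I : Type*} [Fintype I] [Nonempty I]
    (M : Matrix I I ℤ) (hsymm : M.IsSymm)
    (hnegdef : ((-M).map (Int.cast : ℤ → ℝ)).PosDef) :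
    ∃ D : I → ℤ, ∀ i : I, (M *ᵥ D) i < 0 := by
  classical
  refine exists_mulVec_neg_of_det_ne_zero fun h => hnegdef.det_pos.ne' ?_
  rw [← Int.cast_det, det_neg, h, mul_zero, Int.cast_zero]
end

section
/- Let I be a nonempty finite type and let M : Matrix I I ℤ be a matrix satisfying condition (**), i.e. (M *ᵥ 1) i < 0 for every i ∈ I, where 1 denotes the all-ones vector. Then M satisfies condition (*): for every pair of indices i ≠ j in I there exists a vector D : I → ℤ with (M *ᵥ D) k < 0 for every k ∈ I and D i < D j. (First half of Lemma 4.1: condition (**) implies condition (*).) -/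
open Matrix

/-- Condition (**) implies condition (*): if the all-ones vector lies in the
strict Lipman cone of `M`, then for every pair of distinct indices `i ≠ j`
there exists `D` in the strict Lipman cone with `D i < D j`. -/
theorem condition_star_star_implies_condition_star {I : Type*} [Fintype I]
    [Nonempty I] (M : Matrix I I ℤ)
    (hstarstar : ∀ i : I, (M *ᵥ (1 : I → ℤ)) i < 0) :
    ∀ i j : I, i ≠ j →
      ∃ D : I → ℤ, (∀ k : I, (M *ᵥ D) k < 0) ∧ D i < D j := by
  classical
  intro i j hij
  set N : ℤ := 1 + ∑ k, |M k j|
  refine ⟨N • (1 : I → ℤ) + Pi.single j 1, fun k => ?_, ?_⟩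
  · have hN : |M k j| < N := by
      have := Finset.single_le_sum (f := fun k => |M k j|) (fun _ _ => abs_nonneg _)
        (Finset.mem_univ k)
      lia
    have hexp : (M *ᵥ (N • (1 : I → ℤ) + Pi.single j 1)) k =
        N * (M *ᵥ (1 : I → ℤ)) k + M k j := by
      rw [mulVec_add, mulVec_smul, mulVec_single_one]
      rfl
    rw [hexp]
    nlinarith [hstarstar k, abs_nonneg (M k j), le_abs_self (M k j)]
  · simp [hij]
end

section
/- Let n ≥ 1 and let M : Matrix (Fin n) (Fin n) ℤ be the A_n intersection matrix. Define D : Fin n → ℤ by D k = n * ((k : ℤ) + 1) - (k : ℤ) * ((k : ℤ) + 1) / 2 (this corresponds to α_m = n·m − m(m−1)/2 for the 1-indexed coordinate m = k + 1). Then (M *ᵥ D) k < 0 for every k : Fin n, and D is strictly increasing: D k < D l whenever k < l. -/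
open Matrix

/-- The `A_n` intersection matrix: `-2` on the diagonal, `1` between
consecutive indices, `0` elsewhere. -/
def AnMatrix (n : ℕ) : Matrix (Fin n) (Fin n) ℤ :=
  Matrix.of fun i j =>
    if i = j then -2
    else if (i : ℕ) + 1 = (j : ℕ) ∨ (j : ℕ) + 1 = (i : ℕ) then 1
    else 0

/-- Row `k` of `AnMatrix n` acts on the restriction of `f : ℕ → ℤ` as a second difference, with
zero boundary values. -/
theorem AnMatrix_mulVec_apply (n : ℕ) (f : ℕ → ℤ) (k : Fin n) :
    (AnMatrix n *ᵥ fun i : Fin n => f i) k =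
      -2 * f k + (if (k : ℕ) + 1 < n then f (k + 1) else 0) +
        (if 0 < (k : ℕ) then f (k - 1) else 0) := by
  obtain ⟨k, hk⟩ := k
  have key : ∀ j : Fin n, AnMatrix n ⟨k, hk⟩ j * f j =
      (fun j : ℕ => (if j = k then -2 * f j else 0) + (if j = k + 1 then f j else 0) +
        (if 0 < k then (if j = k - 1 then f j else 0) else 0)) j := by
    intro j
    simp only [AnMatrix, Matrix.of_apply, Fin.ext_iff]
    grind
  simp only [Matrix.mulVec, dotProduct]
  rw [Finset.sum_congr rfl fun j _ => key j, Fin.sum_univ_eq_sum_range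
    (fun j : ℕ => (if j = k then -2 * f j else 0) + (if j = k + 1 then f j else 0) +
      (if 0 < k then (if j = k - 1 then f j else 0) else 0)) n]
  have hk' : k - 1 < n := by omega
  by_cases h : 0 < k <;>
    simp [Finset.sum_add_distrib, Finset.sum_ite_eq', h, hk, hk']

/-- The increments of the sequence `j ↦ n(j+1) - j(j+1)/2`. -/
theorem lipmanSequence_succ (n : ℤ) (j : ℕ) :
    n * (((j + 1 : ℕ) : ℤ) + 1) - ((j + 1 : ℕ) : ℤ) * (((j + 1 : ℕ) : ℤ) + 1) / 2 =
      n * ((j : ℤ) + 1) - (j : ℤ) * ((j : ℤ) + 1) / 2 + (n - (j + 1)) := by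
  have h : ((j + 1 : ℕ) : ℤ) * (((j + 1 : ℕ) : ℤ) + 1) =
      (j : ℤ) * ((j : ℤ) + 1) + ((j : ℤ) + 1) * 2 := by
    push_cast; ring
  rw [h, Int.add_mul_ediv_right _ _ two_ne_zero]
  push_cast; ring

/-- For `n ≥ 1`, the vector `D` with `D k = n(k+1) - k(k+1)/2` (that is,
`α_m = nm - m(m-1)/2` in 1-indexed coordinates `m = k+1`) lies in the strict
Lipman cone of the `A_n` intersection matrix and is strictly increasing. -/
theorem An_explicit_strict_lipman_vector (n : ℕ) (hn : 1 ≤ n) :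
    (∀ k : Fin n,
      (AnMatrix n *ᵥ fun k : Fin n =>
        (n : ℤ) * (((k : ℕ) : ℤ) + 1) - ((k : ℕ) : ℤ) * (((k : ℕ) : ℤ) + 1) / 2) k < 0) ∧
    (∀ k l : Fin n, k < l →
      (n : ℤ) * (((k : ℕ) : ℤ) + 1) - ((k : ℕ) : ℤ) * (((k : ℕ) : ℤ) + 1) / 2 <
      (n : ℤ) * (((l : ℕ) : ℤ) + 1) - ((l : ℕ) : ℤ) * (((l : ℕ) : ℤ) + 1) / 2) := by
  obtain ⟨f, hf⟩ : ∃ f : ℕ → ℤ, ∀ j : ℕ,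
      (n : ℤ) * ((j : ℤ) + 1) - (j : ℤ) * ((j : ℤ) + 1) / 2 = f j := ⟨_, fun _ => rfl⟩
  have hzero : f 0 = n := by simp [← hf]
  have hsucc : ∀ j : ℕ, f (j + 1) = f j + (n - (j + 1)) := fun j => by
    rw [← hf, ← hf]; exact lipmanSequence_succ n j
  have hlt : ∀ i j : ℕ, i < j → j < n → f i < f j := by
    intro i j hij
    induction j, hij using Nat.le_induction with
    | base => intro h; have := hsucc i; rw [Nat.succ_eq_add_one] at *; omega
    | succ j _ ih => intro h; have := hsucc j; have := ih (by omega); omega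
  simp only [hf]
  refine ⟨fun k => ?_, fun k l hkl => hlt k l hkl l.isLt⟩
  rw [AnMatrix_mulVec_apply]
  obtain ⟨k, hk⟩ := k
  have hpos : 0 < f k := by
    rcases Nat.eq_zero_or_pos k with rfl | h
    · omega
    · have := hlt 0 k h hk; omega
  have hnext := hsucc k
  cases k with
  | zero => simp only [lt_irrefl, if_false]; split_ifs <;> push_cast at * <;> omega
  | succ k =>
    have hprev := hsucc k
    simp only [Nat.succ_pos, if_true, Nat.add_sub_cancel]
    split_ifs <;> push_cast at * <;> omega
end

section
/- Let n ≥ 1 and let M : Matrix (Fin n) (Fin n) ℤ be the A_n intersection matrix. Then M satisfies condition (*): for every pair of indices i ≠ j in Fin n there exists a vector D : Fin n → ℤ with (M *ᵥ D) k < 0 for every k and D i < D j. (Second half of Lemma 4.1: the A_n intersection matrix satisfies condition (*); together with the failure of (**) for n ≥ 3 this shows the inclusion of Lemma 4.1 is strict.) -/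
open Matrix

/-- The `A_n` matrix applied to the restriction of `f : ℤ → ℤ` is bounded above by the second
difference of `f`, provided `f` is nonnegative at the two points adjacent to the range of indices. -/
theorem AnMatrix_mulVec_le_second_difference (n : ℕ) (f : ℤ → ℤ) (h_left : 0 ≤ f (-1))
    (h_right : 0 ≤ f n) (k : Fin n) :
    (AnMatrix n *ᵥ fun i => f (i : ℕ)) k ≤ f ((k : ℕ) - 1) + f ((k : ℕ) + 1) - 2 * f (k : ℕ) := by
  obtain ⟨k, hk⟩ := k
  have h_sum : (AnMatrix n *ᵥ fun i => f (i : ℕ)) ⟨k, hk⟩ =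
      ∑ j ∈ Finset.range n, ((if k = j then -2 * f j else 0) +
        (if k + 1 = j then f j else 0) + (if j + 1 = k then f j else 0)) := by
    rw [← Fin.sum_univ_eq_sum_range (fun j : ℕ => (if k = j then -2 * f j else 0) +
        (if k + 1 = j then f j else 0) + (if j + 1 = k then f j else 0))]
    change ∑ j : Fin n, AnMatrix n ⟨k, hk⟩ j * f (j : ℕ) = _
    refine Finset.sum_congr rfl fun j _ => ?_
    simp only [AnMatrix, Matrix.of_apply, Fin.ext_iff]
    split_ifs <;> omega
  rw [h_sum, Finset.sum_add_distrib, Finset.sum_add_distrib, Finset.sum_ite_eq,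
    Finset.sum_ite_eq, if_pos (Finset.mem_range.2 hk)]
  have h_succ : (if k + 1 ∈ Finset.range n then f ((k + 1 : ℕ) : ℤ) else 0) ≤ f ((k : ℤ) + 1) := by
    split_ifs with h
    · simp
    · have : (k : ℤ) + 1 = n := by
        rw [Finset.mem_range] at h
        omega
      rwa [this]
  have h_pred : (∑ j ∈ Finset.range n, if j + 1 = k then f (j : ℤ) else 0) ≤ f ((k : ℤ) - 1) := by
    cases k with
    | zero => simpa using h_left
    | succ m => simp [Nat.lt_of_succ_lt hk]
  simp only
  linarith

/-- For `n ≥ 1`, the `A_n` intersection matrix satisfies condition (*): for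
every pair of distinct indices `i ≠ j` there is a vector `D` in the strict
Lipman cone with `D i < D j`. -/
theorem An_satisfies_condition_star (n : ℕ) (hn : 1 ≤ n) :
    ∀ i j : Fin n, i ≠ j →
      ∃ D : Fin n → ℤ, (∀ k : Fin n, (AnMatrix n *ᵥ D) k < 0) ∧ D i < D j := by
  intro i j hij
  rcases lt_or_gt_of_ne (Fin.val_ne_of_ne hij) with h | h
  · refine ⟨fun k => ((k : ℕ) + 1 : ℤ) * (2 * n + 1 - (k : ℕ)), fun k => ?_, ?_⟩
    · refine (AnMatrix_mulVec_le_second_difference n (fun x => (x + 1) * (2 * n + 1 - x))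
        (by simp) (mul_nonneg (by positivity) (by linarith)) k).trans_lt ?_
      linarith
    · have hj := j.isLt
      zify at h hj
      nlinarith
  · refine ⟨fun k => ((n : ℤ) + 1) ^ 2 - ((k : ℕ) + 1) ^ 2, fun k => ?_, ?_⟩
    · refine (AnMatrix_mulVec_le_second_difference n (fun x => ((n : ℤ) + 1) ^ 2 - (x + 1) ^ 2)
        (by simp; positivity) (by simp) k).trans_lt ?_
      linarith
    · zify at h
      nlinarith
end

section
/- Let n ≥ 5 be an integer and let M : Matrix (Fin 4) (Fin 4) ℤ be the symmetric matrix with diagonal entries M 0 0 = M 1 1 = M 2 2 = -n and M 3 3 = -2, with M i 3 = M 3 i = 1 for i ∈ {0,1,2}, and with all other off-diagonal entries 0. Then M does not satisfy condition (**) — indeed (M *ᵥ 1) 3 = 1 > 0, where 1 is the all-ones vector — but M does satisfy condition (*): for every pair of indices i ≠ j in Fin 4 there exists D : Fin 4 → ℤ with (M *ᵥ D) k < 0 for every k and D i < D j. -/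
open Matrix

/-- The intersection matrix of the example in the Remark following
Corollary 5.2 does not satisfy condition (**) — indeed `(M *ᵥ 1) 3 = 1 > 0` —
but it does satisfy condition (*). -/
theorem example_star_not_star_star (n : ℤ) (hn : 5 ≤ n) :
    ((!![-n, 0, 0, 1; 0, -n, 0, 1; 0, 0, -n, 1; 1, 1, 1, -2] *ᵥ
        (1 : Fin 4 → ℤ)) 3 = 1) ∧
    (∀ i j : Fin 4, i ≠ j →
      ∃ D : Fin 4 → ℤ,
        (∀ k : Fin 4,
          (!![-n, 0, 0, 1; 0, -n, 0, 1; 0, 0, -n, 1; 1, 1, 1, -2] *ᵥ D) k < 0) ∧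
        D i < D j) := by
  refine ⟨by simp [mulVec, dotProduct, Fin.sum_univ_four], fun i j hij =>
    ⟨Function.update ![2, 2, 2, 6] j 7, fun k => ?_, ?_⟩⟩
  · fin_cases j <;> fin_cases k <;>
      simp [mulVec, dotProduct, Fin.sum_univ_four, Function.update_apply] <;> lia
  · rw [Function.update_of_ne hij, Function.update_self]
    fin_cases i <;> simp
end
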